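/- Let n ≥ 4, p ≥ 1, let Z_1,…,Z_n be arbitrary vectors in ℝ^p, and let k, k_0 be integers with 2 ≤ k < k_0 ≤ n−2. Then G_n^Z(k_0) − G_n^Z(k) = 2[(n−k−1)(n−1)/((n−k)k)] Σ_{i=k+1}^{k_0} Σ_{j=1}^{k} Z_iᵀZ_j − 2[(k_0−1)(n−1)/((n−k_0)k_0)] Σ_{i=k+1}^{k_0} Σ_{j=k_0+1}^{n} Z_iᵀZ_j + [(n−1)(n−k−k_0)/(k(n−k_0))] Σ_{i,j=k+1, i≠j}^{k_0} Z_iᵀZ_j − [(n−1)(k_0−k)/(k k_0)] Σ_{i,j=1, i≠j}^{k_0} Z_iᵀZ_j + [(n−1)(k_0−k)/((n−k_0)(n−k))] Σ_{i,j=k+1, i≠j}^{n} Z_iᵀZ_j − [2(n−1)(n−k_0−k)(k_0−k)/(k k_0 (n−k)(n−k_0))] Σ_{i=1}^{k} Σ_{j=k_0+1}^{n} Z_iᵀZ_j. -/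

import Mathlib

open Finset

/-- The U-statistic objective function `G_n^Z(k)` computed from vectors
`Z_1, …, Z_n` in `ℝ^p` (indexed by `1, …, n`). -/
noncomputable def GstatZ (p n : ℕ) (Z : ℕ → Fin p → ℝ) (k : ℕ) : ℝ :=
  (1 / ((k : ℝ) * ((n : ℝ) - (k : ℝ)))) *
    ∑ i1 ∈ Finset.Icc 1 k, ∑ i2 ∈ Finset.Icc 1 k,
      ∑ j1 ∈ Finset.Icc (k + 1) n, ∑ j2 ∈ Finset.Icc (k + 1) n,
        if i1 ≠ i2 ∧ j1 ≠ j2 then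
          ∑ l, (Z i1 l - Z j1 l) * (Z i2 l - Z j2 l)
        else 0

theorem offdiag_aux (B : Finset ℕ) (c : ℝ) (g h : ℕ → ℝ) (x : ℕ → ℕ → ℝ) :
    (∑ i ∈ B, ∑ j ∈ B, if i ≠ j then c - g i - h j + x i j else 0) =
      (B.card : ℝ) * ((B.card : ℝ) - 1) * c - ((B.card : ℝ) - 1) * ∑ i ∈ B, g i
        - ((B.card : ℝ) - 1) * ∑ i ∈ B, h i
        + ∑ i ∈ B, ∑ j ∈ B, if i ≠ j then x i j else 0 := by
  have e : ∀ y : ℕ → ℕ → ℝ, (∑ i ∈ B, ∑ j ∈ B, if i ≠ j then y i j else 0) =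
      (∑ i ∈ B, ∑ j ∈ B, y i j) - ∑ i ∈ B, y i i := by
    intro y
    rw [← Finset.sum_sub_distrib]
    refine Finset.sum_congr rfl fun i hi => ?_
    have h1 : ∀ j ∈ B, (if i ≠ j then y i j else 0) = y i j - if i = j then y i j else 0 := by
      intro j _
      by_cases hij : i = j <;> simp [hij]
    rw [Finset.sum_congr rfl h1, Finset.sum_sub_distrib, Finset.sum_ite_eq, if_pos hi]
  rw [e, e]
  simp only [Finset.sum_add_distrib, Finset.sum_sub_distrib, Finset.sum_const, nsmul_eq_mul,
    ← Finset.mul_sum]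
  ring

theorem quad_aux (A B : Finset ℕ) (x : ℕ → ℕ → ℝ) (hx : ∀ i j, x i j = x j i) :
    (∑ i1 ∈ A, ∑ i2 ∈ A, ∑ j1 ∈ B, ∑ j2 ∈ B,
      if i1 ≠ i2 ∧ j1 ≠ j2 then x i1 i2 - x j1 i2 - x i1 j2 + x j1 j2 else 0) =
    (B.card : ℝ) * ((B.card : ℝ) - 1) * (∑ i ∈ A, ∑ j ∈ A, if i ≠ j then x i j else 0)
    + (A.card : ℝ) * ((A.card : ℝ) - 1) * (∑ i ∈ B, ∑ j ∈ B, if i ≠ j then x i j else 0)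
    - 2 * ((A.card : ℝ) - 1) * ((B.card : ℝ) - 1) * ∑ i ∈ A, ∑ j ∈ B, x i j := by
  have h1 : ∀ i1 i2, (∑ j1 ∈ B, ∑ j2 ∈ B,
      if i1 ≠ i2 ∧ j1 ≠ j2 then x i1 i2 - x j1 i2 - x i1 j2 + x j1 j2 else 0) =
      if i1 ≠ i2 then (∑ i ∈ B, ∑ j ∈ B, if i ≠ j then x i j else 0)
        - ((B.card : ℝ) - 1) * (∑ j ∈ B, x i1 j) - ((B.card : ℝ) - 1) * (∑ j ∈ B, x i2 j)
        + (B.card : ℝ) * ((B.card : ℝ) - 1) * x i1 i2 else 0 := by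
    intro i1 i2
    by_cases hi : i1 = i2
    · simp [hi]
    · have := offdiag_aux B (x i1 i2) (fun j => x j i2) (fun j => x i1 j) x
      simp only [ne_eq, hi, not_false_eq_true, true_and, if_true] at this ⊢
      rw [this]
      simp only [hx _ i2]
      ring
  simp only [h1]
  rw [offdiag_aux A _ (fun i1 => ((B.card : ℝ) - 1) * (∑ j ∈ B, x i1 j))
    (fun i2 => ((B.card : ℝ) - 1) * (∑ j ∈ B, x i2 j))
    (fun i1 i2 => (B.card : ℝ) * ((B.card : ℝ) - 1) * x i1 i2)]
  have h2 : ∀ t : ℝ, ∀ i j, (if i ≠ j then t * x i j else 0) = t * if i ≠ j then x i j else 0 := by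
    intro t i j
    split_ifs <;> simp
  simp only [h2, ← Finset.mul_sum]
  ring

theorem union_aux (A B : Finset ℕ) (hd : Disjoint A B) (x : ℕ → ℕ → ℝ)
    (hx : ∀ i j, x i j = x j i) :
    (∑ i ∈ A ∪ B, ∑ j ∈ A ∪ B, if i ≠ j then x i j else 0) =
      (∑ i ∈ A, ∑ j ∈ A, if i ≠ j then x i j else 0)
      + (∑ i ∈ B, ∑ j ∈ B, if i ≠ j then x i j else 0) + 2 * ∑ i ∈ A, ∑ j ∈ B, x i j := by
  have h1 : (∑ i ∈ A, ∑ j ∈ B, if i ≠ j then x i j else 0) = ∑ i ∈ A, ∑ j ∈ B, x i j := by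
    refine Finset.sum_congr rfl fun i hi => Finset.sum_congr rfl fun j hj => ?_
    have hij : i ≠ j := by
      rintro rfl
      exact Finset.disjoint_left.mp hd hi hj
    rw [if_pos hij]
  have h2 : (∑ i ∈ B, ∑ j ∈ A, if i ≠ j then x i j else 0) = ∑ i ∈ A, ∑ j ∈ B, x i j := by
    rw [Finset.sum_comm, ← h1]
    refine Finset.sum_congr rfl fun i hi => Finset.sum_congr rfl fun j hj => ?_
    simp only [hx j i, ne_comm]
  rw [Finset.sum_union hd]
  simp only [Finset.sum_union hd, Finset.sum_add_distrib]
  rw [h1, h2]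
  ring

theorem G_aux (p n : ℕ) (Z : ℕ → Fin p → ℝ) (k : ℕ) (hk : k ≤ n) (x : ℕ → ℕ → ℝ)
    (hx : ∀ i j, x i j = ∑ l, Z i l * Z j l) :
    GstatZ p n Z k = (1 / ((k : ℝ) * ((n : ℝ) - (k : ℝ)))) *
    (((n : ℝ) - k) * (((n : ℝ) - k) - 1) *
      (∑ i ∈ Finset.Icc 1 k, ∑ j ∈ Finset.Icc 1 k, if i ≠ j then x i j else 0)
    + (k : ℝ) * ((k : ℝ) - 1) *
      (∑ i ∈ Finset.Icc (k + 1) n, ∑ j ∈ Finset.Icc (k + 1) n, if i ≠ j then x i j else 0)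
    - 2 * ((k : ℝ) - 1) * (((n : ℝ) - k) - 1) *
      ∑ i ∈ Finset.Icc 1 k, ∑ j ∈ Finset.Icc (k + 1) n, x i j) := by
  have hs : ∀ i j, x i j = x j i := by
    intro i j
    simp only [hx, mul_comm]
  have hq := quad_aux (Finset.Icc 1 k) (Finset.Icc (k + 1) n) x hs
  have c1 : ((Finset.Icc (k + 1) n).card : ℝ) = (n : ℝ) - k := by
    rw [Nat.card_Icc, Nat.add_sub_add_right, Nat.cast_sub hk]
  have c2 : ((Finset.Icc 1 k).card : ℝ) = (k : ℝ) := by simp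
  rw [c1, c2] at hq
  rw [← hq, GstatZ]
  have h3 : ∀ i1 i2 j1 j2, (∑ l, (Z i1 l - Z j1 l) * (Z i2 l - Z j2 l)) =
      x i1 i2 - x j1 i2 - x i1 j2 + x j1 j2 := by
    intro i1 i2 j1 j2
    simp only [hx, ← Finset.sum_sub_distrib, ← Finset.sum_add_distrib]
    refine Finset.sum_congr rfl fun l _ => ?_
    ring
  simp only [h3]

theorem GstatZ_difference_decomposition (n p : ℕ) (Z : ℕ → Fin p → ℝ)
    (k k0 : ℕ) (hk : 2 ≤ k) (hkk0 : k < k0) (hk0 : k0 ≤ n - 2) :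
    GstatZ p n Z k0 - GstatZ p n Z k =
      2 * (((n : ℝ) - (k : ℝ) - 1) * ((n : ℝ) - 1) / (((n : ℝ) - (k : ℝ)) * (k : ℝ))) *
        (∑ i ∈ Finset.Icc (k + 1) k0, ∑ j ∈ Finset.Icc 1 k, ∑ l, Z i l * Z j l)
      - 2 * (((k0 : ℝ) - 1) * ((n : ℝ) - 1) / (((n : ℝ) - (k0 : ℝ)) * (k0 : ℝ))) *
        (∑ i ∈ Finset.Icc (k + 1) k0, ∑ j ∈ Finset.Icc (k0 + 1) n, ∑ l, Z i l * Z j l)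
      + (((n : ℝ) - 1) * ((n : ℝ) - (k : ℝ) - (k0 : ℝ)) / ((k : ℝ) * ((n : ℝ) - (k0 : ℝ)))) *
        (∑ i ∈ Finset.Icc (k + 1) k0, ∑ j ∈ Finset.Icc (k + 1) k0,
          if i ≠ j then ∑ l, Z i l * Z j l else 0)
      - (((n : ℝ) - 1) * ((k0 : ℝ) - (k : ℝ)) / ((k : ℝ) * (k0 : ℝ))) *
        (∑ i ∈ Finset.Icc 1 k0, ∑ j ∈ Finset.Icc 1 k0,
          if i ≠ j then ∑ l, Z i l * Z j l else 0)
      + (((n : ℝ) - 1) * ((k0 : ℝ) - (k : ℝ)) / (((n : ℝ) - (k0 : ℝ)) * ((n : ℝ) - (k : ℝ)))) *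
        (∑ i ∈ Finset.Icc (k + 1) n, ∑ j ∈ Finset.Icc (k + 1) n,
          if i ≠ j then ∑ l, Z i l * Z j l else 0)
      - (2 * ((n : ℝ) - 1) * ((n : ℝ) - (k0 : ℝ) - (k : ℝ)) * ((k0 : ℝ) - (k : ℝ)) /
          ((k : ℝ) * (k0 : ℝ) * ((n : ℝ) - (k : ℝ)) * ((n : ℝ) - (k0 : ℝ)))) *
        (∑ i ∈ Finset.Icc 1 k, ∑ j ∈ Finset.Icc (k0 + 1) n, ∑ l, Z i l * Z j l) := by
  obtain ⟨x, hx⟩ : ∃ x : ℕ → ℕ → ℝ, ∀ i j, x i j = ∑ l, Z i l * Z j l := ⟨_, fun _ _ => rfl⟩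
  have hs : ∀ i j, x i j = x j i := by
    intro i j
    simp only [hx, mul_comm]
  rw [G_aux p n Z k (by omega) x hx, G_aux p n Z k0 (by omega) x hx]
  simp only [← hx]
  have u1 : Finset.Icc 1 k0 = Finset.Icc 1 k ∪ Finset.Icc (k + 1) k0 := by
    ext i
    simp only [Finset.mem_union, Finset.mem_Icc]
    omega
  have u2 : Finset.Icc (k + 1) n = Finset.Icc (k + 1) k0 ∪ Finset.Icc (k0 + 1) n := by
    ext i
    simp only [Finset.mem_union, Finset.mem_Icc]
    omega
  have d1 : Disjoint (Finset.Icc 1 k) (Finset.Icc (k + 1) k0) := by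
    rw [Finset.disjoint_left]
    intro i
    simp only [Finset.mem_Icc]
    omega
  have d2 : Disjoint (Finset.Icc (k + 1) k0) (Finset.Icc (k0 + 1) n) := by
    rw [Finset.disjoint_left]
    intro i
    simp only [Finset.mem_Icc]
    omega
  have hba : (∑ i ∈ Finset.Icc (k + 1) k0, ∑ j ∈ Finset.Icc 1 k, x i j) =
      ∑ i ∈ Finset.Icc 1 k, ∑ j ∈ Finset.Icc (k + 1) k0, x i j := by
    rw [Finset.sum_comm]
    exact Finset.sum_congr rfl fun i _ => Finset.sum_congr rfl fun j _ => hs j i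
  rw [hba, u1, u2, union_aux _ _ d1 x hs, union_aux _ _ d2 x hs, Finset.sum_union d1]
  simp only [Finset.sum_union d2, Finset.sum_add_distrib]
  have n1 : (k : ℝ) ≠ 0 := by
    have : k ≠ 0 := by omega
    exact_mod_cast this
  have n2 : (k0 : ℝ) ≠ 0 := by
    have : k0 ≠ 0 := by omega
    exact_mod_cast this
  have n3 : (n : ℝ) - k ≠ 0 := by
    have : (k : ℝ) < n := by exact_mod_cast (by omega : k < n)
    linarith
  have n4 : (n : ℝ) - k0 ≠ 0 := by
    have : (k0 : ℝ) < n := by exact_mod_cast (by omega : k0 < n)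
    linarith
  generalize (∑ i ∈ Finset.Icc 1 k, ∑ j ∈ Finset.Icc 1 k, if i ≠ j then x i j else 0) = Saa
  generalize (∑ i ∈ Finset.Icc (k + 1) k0, ∑ j ∈ Finset.Icc (k + 1) k0,
    if i ≠ j then x i j else 0) = Sbb
  generalize (∑ i ∈ Finset.Icc (k0 + 1) n, ∑ j ∈ Finset.Icc (k0 + 1) n,
    if i ≠ j then x i j else 0) = Scc
  generalize (∑ i ∈ Finset.Icc 1 k, ∑ j ∈ Finset.Icc (k + 1) k0, x i j) = Cab
  generalize (∑ i ∈ Finset.Icc 1 k, ∑ j ∈ Finset.Icc (k0 + 1) n, x i j) = Cac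
  generalize (∑ i ∈ Finset.Icc (k + 1) k0, ∑ j ∈ Finset.Icc (k0 + 1) n, x i j) = Cbc
  generalize (k : ℝ) = a at *
  generalize (k0 : ℝ) = b at *
  generalize (n : ℝ) = N at *
  field_simp
  ring
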